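/- arXiv:math/9910176 — 3 statements merged into one kernel-verified Lean document; each statement's English description precedes it below -/
import Mathlib

section
/- Let a = 1/20, b = 19/20 and G(u,q,d,α) = (dq − u²)(b + a·u^{5/2})/u^{5/2} + q(u² − dq)/u² + α for u > 0. Set u₁ = b^{2/5}/(2^{4/5} a^{2/5}), q₁ = 5b/(4√u₁), d₁ = 4u₁^{5/2}/(5b), α₁ = 0. Then at the point (u₁,q₁,d₁,α₁) the pitchfork conditions hold: G = 0, ∂G/∂u = 0, ∂G/∂q = 0, ∂²G/∂u² = 0, with ∂²G/∂u∂q ≠ 0 and ∂³G/∂u³ ≠ 0 (this is the pitchfork P₁ of the L–H transition problem, lying in the physical region u, q, d > 0 with α = 0). -/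
/-- Numerical constant `a = 0.05` of the L–H transition problem. -/
noncomputable def aC : ℝ := 1/20
/-- Numerical constant `b = 0.95` of the L–H transition problem. -/
noncomputable def bC : ℝ := 19/20

/-- The universal unfolding `P_LH` of the L–H plasma confinement transition problem:
`G(u,q,d,α) = (dq − u²)(b + a·u^{5/2})/u^{5/2} + q(u² − dq)/u² + α`. -/
noncomputable def G (u q d al : ℝ) : ℝ :=
  (d*q - u^2) * (bC + aC * u ^ ((5:ℝ)/2)) / u ^ ((5:ℝ)/2) + q * (u^2 - d*q) / u^2 + al

/-- `∂G/∂u` -/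
noncomputable def Gu (u q d al : ℝ) : ℝ := deriv (fun t => G t q d al) u
/-- `∂G/∂q` -/
noncomputable def Gq (u q d al : ℝ) : ℝ := deriv (fun t => G u t d al) q
/-- `∂²G/∂u²` -/
noncomputable def Guu (u q d al : ℝ) : ℝ := deriv (fun t => Gu t q d al) u
/-- `∂²G/∂u∂q` -/
noncomputable def Guq (u q d al : ℝ) : ℝ := deriv (fun t => Gu u t d al) q
/-- `∂²G/∂q∂u` -/
noncomputable def Gqu (u q d al : ℝ) : ℝ := deriv (fun t => Gq t q d al) u
/-- `∂²G/∂q²` -/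
noncomputable def Gqq (u q d al : ℝ) : ℝ := deriv (fun t => Gq u t d al) q
/-- `∂³G/∂u³` -/
noncomputable def Guuu (u q d al : ℝ) : ℝ := deriv (fun t => Guu t q d al) u
/-- Determinant of the Hessian of `G` with respect to `(u,q)`. -/
noncomputable def detH (u q d al : ℝ) : ℝ :=
  Guu u q d al * Gqq u q d al - Guq u q d al * Gqu u q d al

theorem sq_rpow_neg_half {s : ℝ} (hs : 0 < s) (n : ℕ) :
    (s ^ 2) ^ (-(n : ℝ) / 2) = (s ^ n)⁻¹ := by
  rw [← Real.rpow_natCast s 2, ← Real.rpow_mul hs.le, ← Real.rpow_natCast s n,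
    ← Real.rpow_neg hs.le]
  congr 1
  push_cast
  ring

theorem hasDerivAt_const_mul_rpow {u : ℝ} (hu : 0 < u) (c p r : ℝ) (hr : p - 1 = r) :
    HasDerivAt (fun t : ℝ => c * t ^ p) (c * p * u ^ r) u := by
  subst hr
  simpa only [mul_assoc] using
    (Real.hasDerivAt_rpow_const (p := p) (Or.inl hu.ne')).const_mul c

theorem G_eq_of_pos {u : ℝ} (hu : 0 < u) (q d al : ℝ) :
    G u q d al = bC * d * q * u ^ (-5 / 2 : ℝ) + -bC * u ^ (-1 / 2 : ℝ) + -aC * u ^ (2 : ℝ)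
      + -d * q ^ 2 * u ^ (-2 : ℝ) + (aC * d * q + q + al) := by
  obtain ⟨s, hs, rfl⟩ : ∃ s : ℝ, 0 < s ∧ s ^ 2 = u :=
    ⟨√u, Real.sqrt_pos.2 hu, Real.sq_sqrt hu.le⟩
  have h5 := sq_rpow_neg_half hs 5
  have h1 := sq_rpow_neg_half hs 1
  have h4 := sq_rpow_neg_half hs 4
  have hp : (s ^ 2) ^ ((5 : ℝ) / 2) = s ^ 5 := by
    rw [← inv_inj, ← h5, ← Real.rpow_neg hu.le]
    norm_num
  norm_num at h5 h1 h4
  unfold G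
  norm_num [hp, h5, h1, h4]
  field_simp
  ring

theorem Gu_eq_of_pos {u : ℝ} (hu : 0 < u) (q d al : ℝ) :
    Gu u q d al = bC * d * q * (-5 / 2) * u ^ (-7 / 2 : ℝ) + -bC * (-1 / 2) * u ^ (-3 / 2 : ℝ)
      + -aC * 2 * u ^ (1 : ℝ) + -d * q ^ 2 * (-2) * u ^ (-3 : ℝ) := by
  have h := ((((hasDerivAt_const_mul_rpow hu (bC * d * q) (-5 / 2) (-7 / 2) (by norm_num)).add
    (hasDerivAt_const_mul_rpow hu (-bC) (-1 / 2) (-3 / 2) (by norm_num))).add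
    (hasDerivAt_const_mul_rpow hu (-aC) 2 1 (by norm_num))).add
    (hasDerivAt_const_mul_rpow hu (-d * q ^ 2) (-2) (-3) (by norm_num))).add_const
    (aC * d * q + q + al)
  refine (h.congr_of_eventuallyEq ?_).deriv
  filter_upwards [lt_mem_nhds hu] with t ht
  exact G_eq_of_pos ht q d al

theorem Guu_eq_of_pos {u : ℝ} (hu : 0 < u) (q d al : ℝ) :
    Guu u q d al = bC * d * q * (-5 / 2) * (-7 / 2) * u ^ (-9 / 2 : ℝ)
      + -bC * (-1 / 2) * (-3 / 2) * u ^ (-5 / 2 : ℝ)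
      + -aC * 2 * 1 * u ^ (0 : ℝ) + -d * q ^ 2 * (-2) * (-3) * u ^ (-4 : ℝ) := by
  have h := (((hasDerivAt_const_mul_rpow hu (bC * d * q * (-5 / 2)) (-7 / 2) (-9 / 2)
      (by norm_num)).add
    (hasDerivAt_const_mul_rpow hu (-bC * (-1 / 2)) (-3 / 2) (-5 / 2) (by norm_num))).add
    (hasDerivAt_const_mul_rpow hu (-aC * 2) 1 0 (by norm_num))).add
    (hasDerivAt_const_mul_rpow hu (-d * q ^ 2 * (-2)) (-3) (-4) (by norm_num))
  refine (h.congr_of_eventuallyEq ?_).deriv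
  filter_upwards [lt_mem_nhds hu] with t ht
  exact Gu_eq_of_pos ht q d al

theorem Guuu_eq_of_pos {u : ℝ} (hu : 0 < u) (q d al : ℝ) :
    Guuu u q d al = bC * d * q * (-5 / 2) * (-7 / 2) * (-9 / 2) * u ^ (-11 / 2 : ℝ)
      + -bC * (-1 / 2) * (-3 / 2) * (-5 / 2) * u ^ (-7 / 2 : ℝ)
      + -aC * 2 * 1 * 0 * u ^ (-1 : ℝ) + -d * q ^ 2 * (-2) * (-3) * (-4) * u ^ (-5 : ℝ) := by
  have h := (((hasDerivAt_const_mul_rpow hu (bC * d * q * (-5 / 2) * (-7 / 2)) (-9 / 2) (-11 / 2)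
      (by norm_num)).add
    (hasDerivAt_const_mul_rpow hu (-bC * (-1 / 2) * (-3 / 2)) (-5 / 2) (-7 / 2)
      (by norm_num))).add
    (hasDerivAt_const_mul_rpow hu (-aC * 2 * 1) 0 (-1) (by norm_num))).add
    (hasDerivAt_const_mul_rpow hu (-d * q ^ 2 * (-2) * (-3)) (-4) (-5) (by norm_num))
  refine (h.congr_of_eventuallyEq ?_).deriv
  filter_upwards [lt_mem_nhds hu] with t ht
  exact Guu_eq_of_pos ht q d al

theorem hasDerivAt_quadratic (A B C q : ℝ) :
    HasDerivAt (fun t : ℝ => A * t ^ 2 + B * t + C) (A * (2 * q) + B) q := by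
  simpa using ((((hasDerivAt_id q).pow 2).const_mul A).add
    ((hasDerivAt_id q).const_mul B)).add_const C

theorem Gq_eq_of_pos {u : ℝ} (hu : 0 < u) (q d al : ℝ) :
    Gq u q d al = -d * u ^ (-2 : ℝ) * (2 * q) + (bC * d * u ^ (-5 / 2 : ℝ) + aC * d + 1) := by
  refine ((hasDerivAt_quadratic (-d * u ^ (-2 : ℝ)) (bC * d * u ^ (-5 / 2 : ℝ) + aC * d + 1)
    (-bC * u ^ (-1 / 2 : ℝ) + -aC * u ^ (2 : ℝ) + al) q).congr_of_eventuallyEq ?_).deriv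
  refine Filter.Eventually.of_forall fun t => ?_
  simp only [G_eq_of_pos hu]
  ring

theorem Guq_eq_of_pos {u : ℝ} (hu : 0 < u) (q d al : ℝ) :
    Guq u q d al = 2 * d * u ^ (-3 : ℝ) * (2 * q) + -5 / 2 * bC * d * u ^ (-7 / 2 : ℝ) := by
  refine ((hasDerivAt_quadratic (2 * d * u ^ (-3 : ℝ)) (-5 / 2 * bC * d * u ^ (-7 / 2 : ℝ))
    (-bC * (-1 / 2) * u ^ (-3 / 2 : ℝ) + -aC * 2 * u ^ (1 : ℝ)) q).congr_of_eventuallyEq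
    ?_).deriv
  refine Filter.Eventually.of_forall fun t => ?_
  simp only [Gu_eq_of_pos hu]
  ring

/-- The first pitchfork `P₁` of the L–H problem, in the physical region
`u, q, d > 0` with `α = 0`. -/
theorem LH_pitchfork_one (u1 q1 d1 al1 : ℝ)
    (hu : u1 = bC ^ ((2:ℝ)/5) / ((2:ℝ) ^ ((4:ℝ)/5) * aC ^ ((2:ℝ)/5)))
    (hq : q1 = 5*bC / (4 * Real.sqrt u1))
    (hd : d1 = 4 * u1 ^ ((5:ℝ)/2) / (5*bC))
    (hal : al1 = 0) :
    u1 > 0 ∧ q1 > 0 ∧ d1 > 0 ∧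
    G u1 q1 d1 al1 = 0 ∧ Gu u1 q1 d1 al1 = 0 ∧ Gq u1 q1 d1 al1 = 0 ∧
    Guu u1 q1 d1 al1 = 0 ∧ Guq u1 q1 d1 al1 ≠ 0 ∧ Guuu u1 q1 d1 al1 ≠ 0 := by
  have ha : (0 : ℝ) < aC := by norm_num [aC]
  have hb : (0 : ℝ) < bC := by norm_num [bC]
  have hpos : 0 < u1 := by rw [hu]; positivity
  have hroot : u1 ^ ((5 : ℝ) / 2) = 19 / 4 := by
    rw [hu, Real.div_rpow (by positivity) (by positivity),
      Real.mul_rpow (by positivity) (by positivity), ← Real.rpow_mul hb.le,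
      ← Real.rpow_mul ha.le, ← Real.rpow_mul zero_le_two]
    norm_num [aC, bC]
  obtain ⟨s, hs, rfl⟩ : ∃ s : ℝ, 0 < s ∧ s ^ 2 = u1 :=
    ⟨√u1, Real.sqrt_pos.2 hpos, Real.sq_sqrt hpos.le⟩
  have hp : (s ^ 2) ^ ((5 : ℝ) / 2) = s ^ 5 := by
    rw [← inv_inj, ← sq_rpow_neg_half hs 5, ← Real.rpow_neg hpos.le]
    norm_num
  have hs5 : s ^ 5 = 19 / 4 := hp ▸ hroot
  have hb5 : bC = s ^ 5 / 5 := by rw [hs5, bC]; norm_num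
  have hq' : q1 = s ^ 4 / 4 := by
    rw [hq, Real.sqrt_sq hs.le, hb5]
    field_simp
  have hd' : d1 = 4 := by
    rw [hd, hp, hb5]
    field_simp
  have ha' : aC = 1 / 20 := rfl
  clear hu hq hd
  have h4 := sq_rpow_neg_half hs 4
  have h5 := sq_rpow_neg_half hs 5
  have h6 := sq_rpow_neg_half hs 6
  have h7 := sq_rpow_neg_half hs 7
  have h8 := sq_rpow_neg_half hs 8
  have h9 := sq_rpow_neg_half hs 9
  have h10 := sq_rpow_neg_half hs 10
  have h11 := sq_rpow_neg_half hs 11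
  have h3 := sq_rpow_neg_half hs 3
  norm_num only [Nat.cast_ofNat] at h3 h4 h5 h6 h7 h8 h9 h10 h11
  subst hq' hd' hal
  refine ⟨hpos, by positivity, by norm_num, ?_, ?_, ?_, ?_, ?_, ?_⟩
  · rw [G, hp, hb5, ha']
    field_simp
    ring
  · norm_num only [Gu_eq_of_pos hpos, Real.rpow_one, h3, h6, h7, hb5, ha']
    field_simp
    ring
  · norm_num only [Gq_eq_of_pos hpos, h4, h5, hb5, ha']
    field_simp
    ring
  · norm_num only [Guu_eq_of_pos hpos, Real.rpow_zero, h5, h8, h9, hb5, ha']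
    field_simp
    ring
  · have : Guq (s ^ 2) (s ^ 4 / 4) 4 0 = 2 / s ^ 2 := by
      norm_num only [Guq_eq_of_pos hpos, h6, h7, hb5, ha']
      field_simp
      ring
    rw [this]
    positivity
  · have : Guuu (s ^ 2) (s ^ 4 / 4) 4 0 = -(3 / 2) / s ^ 2 := by
      norm_num only [Guuu_eq_of_pos hpos, h7, h10, h11, hb5, ha']
      field_simp
      ring
    rw [this]
    exact (div_neg_of_neg_of_pos (by norm_num) (by positivity)).ne
end

section
/- Let a = 1/20, b = 19/20 and G(u,q,d,α) = (dq − u²)(b + a·u^{5/2})/u^{5/2} + q(u² − dq)/u² + α for u > 0. Set u₂ = (173 + 70√6)^{1/5} b^{2/5} / (2·2^{2/5} a^{2/5}), q₂ = 5b(2 + √6)/(16√u₂), d₂ = 8u₂^{5/2}(2 + √6)/(5b), α₂ = −5b(2 + √6)/(2√u₂). Then at the point (u₂,q₂,d₂,α₂) the pitchfork conditions hold: G = 0, ∂G/∂u = 0, ∂G/∂q = 0, ∂²G/∂u² = 0, with ∂²G/∂u∂q ≠ 0 and ∂³G/∂u³ ≠ 0 (the second pitchfork P₂ of the L–H problem,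 also in the physical region u, q, d > 0). -/
theorem hasDerivAt_inv_sqrt {t : ℝ} (ht : 0 < t) :
    HasDerivAt (fun x : ℝ => (√x)⁻¹) (-(√t)⁻¹ ^ 3 / 2) t := by
  have hs : √t ≠ 0 := (Real.sqrt_pos.2 ht).ne'
  refine ((Real.hasDerivAt_sqrt ht.ne').fun_inv hs).congr_deriv ?_
  field_simp

theorem rpow_five_halves {t : ℝ} (ht : 0 ≤ t) : t ^ ((5 : ℝ) / 2) = √t ^ 5 := by
  rw [Real.sqrt_eq_rpow, ← Real.rpow_natCast, ← Real.rpow_mul ht]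
  norm_num

theorem G_eq {t : ℝ} (ht : 0 < t) (q d al : ℝ) :
    G t q d al = bC * (d * q) * (√t)⁻¹ ^ 5 + aC * (d * q) - bC * (√t)⁻¹ - aC * t ^ 2 + q
      - d * q ^ 2 * (√t)⁻¹ ^ 4 + al := by
  have hs : √t ≠ 0 := (Real.sqrt_pos.2 ht).ne'
  rw [G, rpow_five_halves ht.le]
  obtain ⟨w, hw⟩ : ∃ w, w = √t := ⟨_, rfl⟩
  have ht2 : t = w ^ 2 := by rw [hw, Real.sq_sqrt ht.le]
  rw [← hw] at hs ⊢
  rw [ht2]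
  field_simp
  ring

theorem Gu_eq {t : ℝ} (ht : 0 < t) (q d al : ℝ) :
    Gu t q d al = -(5 / 2) * bC * (d * q) * (√t)⁻¹ ^ 7 + bC / 2 * (√t)⁻¹ ^ 3 - 2 * aC * t
      + 2 * d * q ^ 2 * (√t)⁻¹ ^ 6 := by
  have h : (fun x => G x q d al) =ᶠ[nhds t] _ :=
    (lt_mem_nhds ht).mono fun x hx => G_eq hx q d al
  have hv := hasDerivAt_inv_sqrt ht
  rw [Gu, h.deriv_eq]
  refine HasDerivAt.deriv ?_
  convert (((((((hv.fun_pow 5).const_mul (bC * (d * q))).add_const (aC * (d * q))).fun_sub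
    (hv.const_mul bC)).fun_sub ((hasDerivAt_pow 2 t).const_mul aC)).add_const q).fun_sub
    ((hv.fun_pow 4).const_mul (d * q ^ 2))).add_const al using 1
  norm_num
  ring

theorem Gq_eq {t : ℝ} (ht : 0 < t) (q d al : ℝ) :
    Gq t q d al = bC * d * (√t)⁻¹ ^ 5 + aC * d + 1 - 2 * d * q * (√t)⁻¹ ^ 4 := by
  have h : (fun x => G t x d al) = _ := funext fun x => G_eq ht x d al
  have hi := hasDerivAt_id' q
  rw [Gq, h]
  refine HasDerivAt.deriv ?_
  convert ((((((((hi.const_mul d).const_mul bC).mul_const ((√t)⁻¹ ^ 5)).fun_add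
    ((hi.const_mul d).const_mul aC)).sub_const (bC * (√t)⁻¹)).sub_const (aC * t ^ 2)).fun_add
    hi).fun_sub (((hasDerivAt_pow 2 q).const_mul d).mul_const ((√t)⁻¹ ^ 4))).add_const al using 1
  push_cast
  ring

theorem Guq_eq {t : ℝ} (ht : 0 < t) (q d al : ℝ) :
    Guq t q d al = -(5 / 2) * bC * d * (√t)⁻¹ ^ 7 + 4 * d * q * (√t)⁻¹ ^ 6 := by
  have h : (fun x => Gu t x d al) = _ := funext fun x => Gu_eq ht x d al
  have hi := hasDerivAt_id' q
  rw [Guq, h]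
  refine HasDerivAt.deriv ?_
  convert ((((((hi.const_mul d).const_mul (-(5 / 2) * bC)).mul_const ((√t)⁻¹ ^ 7)).add_const
    (bC / 2 * (√t)⁻¹ ^ 3)).sub_const (2 * aC * t)).fun_add
    (((hasDerivAt_pow 2 q).const_mul (2 * d)).mul_const ((√t)⁻¹ ^ 6))) using 1
  push_cast
  ring

theorem Guu_eq {t : ℝ} (ht : 0 < t) (q d al : ℝ) :
    Guu t q d al = 35 / 4 * bC * (d * q) * (√t)⁻¹ ^ 9 - 3 / 4 * bC * (√t)⁻¹ ^ 5 - 2 * aC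
      - 6 * d * q ^ 2 * (√t)⁻¹ ^ 8 := by
  have h : (fun x => Gu x q d al) =ᶠ[nhds t] _ :=
    (lt_mem_nhds ht).mono fun x hx => Gu_eq hx q d al
  have hv := hasDerivAt_inv_sqrt ht
  rw [Guu, h.deriv_eq]
  refine HasDerivAt.deriv ?_
  convert ((((hv.fun_pow 7).const_mul (-(5 / 2) * bC * (d * q))).fun_add
    ((hv.fun_pow 3).const_mul (bC / 2))).fun_sub ((hasDerivAt_id' t).const_mul (2 * aC))).fun_add
    ((hv.fun_pow 6).const_mul (2 * d * q ^ 2)) using 1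
  norm_num
  ring

theorem Guuu_eq {t : ℝ} (ht : 0 < t) (q d al : ℝ) :
    Guuu t q d al = -(315 / 8) * bC * (d * q) * (√t)⁻¹ ^ 11 + 15 / 8 * bC * (√t)⁻¹ ^ 7
      + 24 * d * q ^ 2 * (√t)⁻¹ ^ 10 := by
  have h : (fun x => Guu x q d al) =ᶠ[nhds t] _ :=
    (lt_mem_nhds ht).mono fun x hx => Guu_eq hx q d al
  have hv := hasDerivAt_inv_sqrt ht
  rw [Guuu, h.deriv_eq]
  refine HasDerivAt.deriv ?_
  convert ((((hv.fun_pow 9).const_mul (35 / 4 * bC * (d * q))).fun_sub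
    ((hv.fun_pow 5).const_mul (3 / 4 * bC))).sub_const (2 * aC)).fun_sub
    ((hv.fun_pow 8).const_mul (6 * d * q ^ 2)) using 1
  norm_num
  ring

/-- The second pitchfork `P₂` of the L–H problem, also in the physical region
`u, q, d > 0`. -/
theorem LH_pitchfork_two (u2 q2 d2 al2 : ℝ)
    (hu : u2 = (173 + 70 * Real.sqrt 6) ^ ((1:ℝ)/5) * bC ^ ((2:ℝ)/5) /
      (2 * (2:ℝ) ^ ((2:ℝ)/5) * aC ^ ((2:ℝ)/5)))
    (hq : q2 = 5*bC*(2 + Real.sqrt 6) / (16 * Real.sqrt u2))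
    (hd : d2 = 8 * u2 ^ ((5:ℝ)/2) * (2 + Real.sqrt 6) / (5*bC))
    (hal : al2 = -(5*bC*(2 + Real.sqrt 6)) / (2 * Real.sqrt u2)) :
    u2 > 0 ∧ q2 > 0 ∧ d2 > 0 ∧
    G u2 q2 d2 al2 = 0 ∧ Gu u2 q2 d2 al2 = 0 ∧ Gq u2 q2 d2 al2 = 0 ∧
    Guu u2 q2 d2 al2 = 0 ∧ Guq u2 q2 d2 al2 ≠ 0 ∧ Guuu u2 q2 d2 al2 ≠ 0 := by
  have hr : (√6 : ℝ) ^ 2 = 6 := Real.sq_sqrt (by norm_num)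
  have hr0 : (0 : ℝ) < √6 := Real.sqrt_pos.2 (by norm_num)
  generalize √6 = r at hu hq hd hal hr hr0
  have hu0 : 0 < u2 := by
    rw [hu]
    unfold aC bC
    positivity
  have hu5 : u2 ^ 5 = (173 + 70 * r) * (19 / 20) ^ 2 / (128 * (1 / 20) ^ 2) := by
    have pow5 (x y : ℝ) (hx : 0 ≤ x) : (x ^ (y / 5)) ^ 5 = x ^ y := by
      rw [← Real.rpow_natCast, ← Real.rpow_mul hx]
      norm_num
    rw [hu, div_pow, mul_pow, mul_pow, mul_pow, pow5 _ _ (by positivity),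
      pow5 _ _ (by norm_num [bC]), pow5 _ _ (by norm_num), pow5 _ _ (by norm_num [aC])]
    norm_num [aC, bC]
  have hw0 : 0 < √u2 := Real.sqrt_pos.2 hu0
  have hw5 : √u2 ^ 5 = 19 / 16 * (14 + 5 * r) := by
    refine (pow_left_inj₀ (by positivity) (by positivity) two_ne_zero).1 ?_
    rw [← pow_mul, mul_comm 5 2, pow_mul, Real.sq_sqrt hu0.le, hu5]
    linear_combination (-(19 / 16) ^ 2 * 25) * hr
  have hut : u2 = √u2 ^ 2 := (Real.sq_sqrt hu0.le).symm
  rw [rpow_five_halves hu0.le, hw5] at hd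
  obtain ⟨v, hv⟩ : ∃ v, v = (√u2)⁻¹ := ⟨_, rfl⟩
  have hv0 : 0 < v := hv ▸ inv_pos.2 hw0
  have hKv : 19 / 16 * (14 + 5 * r) * v ^ 5 = 1 := by
    rw [← hw5, hv, ← mul_pow, mul_inv_cancel₀ hw0.ne', one_pow]
  have hq' : q2 = 19 / 64 * (2 + r) * v := by
    rw [hq, hv, bC]
    field_simp
    ring
  have hal' : al2 = -(19 / 8) * (2 + r) * v := by
    rw [hal, hv, bC]
    field_simp
    ring
  have hd' : d2 = 4 * (29 + 12 * r) := by
    rw [hd, bC]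
    linear_combination 10 * hr
  have hu' : u2 = 19 / 16 * (14 + 5 * r) * v ^ 3 := by
    rw [hv, ← hw5, inv_pow]
    field_simp
    exact hut
  have hdq : d2 * q2 * v ^ 4 = 5 + 2 * r := by
    rw [hq', hd']
    linear_combination (5 + 2 * r) * hKv + 19 / 8 * v ^ 5 * hr
  rw [G_eq hu0, Gu_eq hu0, Gq_eq hu0, Guu_eq hu0, Guq_eq hu0, Guuu_eq hu0, ← hv]
  clear hv
  have hq0 : 0 < q2 := by rw [hq']; positivity
  have hd0 : 0 < d2 := by rw [hd']; positivity
  refine ⟨hu0, hq0, hd0, ?_, ?_, ?_, ?_, ?_, ?_⟩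
  · rw [hq', hd'] at hdq
    rw [hq', hd', hu', hal', aC, bC]
    linear_combination (19 / 20 * v - 19 / 64 * (2 + r) * v) * hdq
      - 19 / 320 * (14 + 5 * r) * v * hKv + 19 / 160 * v * hr
  · rw [hq', hd'] at hdq
    rw [hq', hd', hu', aC, bC]
    linear_combination (-(19 / 8) * v ^ 3 + 19 / 32 * (2 + r) * v ^ 3) * hdq + 19 / 16 * v ^ 3 * hr
  · rw [hd'] at hdq ⊢
    rw [aC, bC]
    linear_combination -2 * hdq + 8 / 5 * (2 + r) * hKv - 19 / 2 * v ^ 5 * hr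
  · rw [hq', hd'] at hdq
    rw [hq', hd', aC, bC]
    linear_combination (133 / 16 * v ^ 5 - 57 / 32 * (2 + r) * v ^ 5) * hdq + 1 / 10 * hKv - 57 / 16 * v ^ 5 * hr
  · have h : -(5 / 2) * bC * d2 * v ^ 7 + 4 * d2 * q2 * v ^ 6 = (12 + 4 * r) * v ^ 2 := by
      rw [hd'] at hdq ⊢
      rw [bC]
      linear_combination 4 * v ^ 2 * hdq - 4 * (2 + r) * v ^ 2 * hKv + 95 / 4 * v ^ 7 * hr
    rw [h]
    positivity
  · have h : -(315 / 8) * bC * (d2 * q2) * v ^ 11 + 15 / 8 * bC * v ^ 7 + 24 * d2 * q2 ^ 2 * v ^ 10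
        = -((30 + 45 / 4 * r) * (19 / 20) * v ^ 7) := by
      rw [hq', hd'] at hdq
      rw [hq', hd', bC]
      linear_combination (-(5985 / 160) * v ^ 7 + 57 / 8 * (2 + r) * v ^ 7) * hdq + 57 / 4 * v ^ 7 * hr
    rw [h]
    exact neg_ne_zero.2 (by positivity)
end

section
/- Let a = 1/20, b = 19/20 and G(u,q,d,α) = (dq − u²)(b + a·u^{5/2})/u^{5/2} + q(u² − dq)/u² + α for u > 0. Set u₃ = (173 − 70√6)^{1/5} b^{2/5} / (2·2^{2/5} a^{2/5}), q₃ = −5b(√6 − 2)/(16√u₃), d₃ = −8u₃^{5/2}(√6 − 2)/(5b), α₃ = 5b(√6 − 2)/(2√u₃). Then at the point (u₃,q₃,d₃,α₃) the pitchfork conditions hold: G = 0, ∂G/∂u = 0, ∂G/∂q = 0, ∂²G/∂u² = 0, with ∂²G/∂u∂q ≠ 0 and ∂³G/∂u³ ≠ 0; this third pitchfork P₃ lies in the unphysical region q < 0, d < 0. -/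
/-- A four-term generalized polynomial in `t` with real exponents, plus a constant. -/
noncomputable def fourTerm (c₁ c₂ c₃ c₄ p₁ p₂ p₃ p₄ k t : ℝ) : ℝ :=
  c₁ * t ^ p₁ + c₂ * t ^ p₂ + c₃ * t ^ p₃ + c₄ * t ^ p₄ + k

theorem deriv_eq_of_eqOn_fourTerm {f : ℝ → ℝ} {c₁ c₂ c₃ c₄ p₁ p₂ p₃ p₄ k : ℝ}
    (hf : ∀ t, 0 < t → f t = fourTerm c₁ c₂ c₃ c₄ p₁ p₂ p₃ p₄ k t) (t : ℝ) (ht : 0 < t) :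
    deriv f t = fourTerm (c₁ * p₁) (c₂ * p₂) (c₃ * p₃) (c₄ * p₄)
      (p₁ - 1) (p₂ - 1) (p₃ - 1) (p₄ - 1) 0 t := by
  have hev : f =ᶠ[nhds t] fourTerm c₁ c₂ c₃ c₄ p₁ p₂ p₃ p₄ k := by
    filter_upwards [lt_mem_nhds ht] with s hs using hf s hs
  rw [hev.deriv_eq]
  have h (c p : ℝ) : HasDerivAt (fun s : ℝ => c * s ^ p) (c * (p * t ^ (p - 1))) t :=
    (Real.hasDerivAt_rpow_const (Or.inl ht.ne')).const_mul c
  have := ((((h c₁ p₁).add (h c₂ p₂)).add (h c₃ p₃)).add (h c₄ p₄)).add_const k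
  refine (HasDerivAt.deriv (this.congr_of_eventuallyEq (Filter.Eventually.of_forall
    fun s => ?_))).trans ?_
  · simp [fourTerm]
  · simp only [fourTerm]; ring

theorem sq_rpow_half_int {r : ℝ} (hr : 0 < r) (n : ℤ) (x : ℝ) (hx : 2 * x = n) :
    (r ^ 2) ^ x = r ^ n := by
  rw [← Real.rpow_natCast r 2, ← Real.rpow_mul hr.le, ← Real.rpow_intCast, ← hx]
  norm_num

theorem G_eq_fourTerm (q d al t : ℝ) (ht : 0 < t) :
    G t q d al = fourTerm (d * q * bC) (-bC) (-aC) (-(d * q ^ 2))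
      (-5 / 2) (-1 / 2) 2 (-2) (aC * d * q + q + al) t := by
  obtain ⟨r, hr, rfl⟩ : ∃ r : ℝ, 0 < r ∧ t = r ^ 2 :=
    ⟨√t, Real.sqrt_pos.2 ht, (Real.sq_sqrt ht.le).symm⟩
  simp only [G, fourTerm]
  rw [sq_rpow_half_int hr 5 (5 / 2) (by norm_num), sq_rpow_half_int hr (-5) (-5 / 2) (by norm_num),
    sq_rpow_half_int hr (-1) (-1 / 2) (by norm_num), sq_rpow_half_int hr 4 2 (by norm_num),
    sq_rpow_half_int hr (-4) (-2) (by norm_num)]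
  simp only [zpow_neg, zpow_ofNat]
  field_simp
  ring

theorem Gu_eq_fourTerm (q d al t : ℝ) (ht : 0 < t) :
    Gu t q d al = fourTerm (d * q * bC * (-5 / 2)) (-bC * (-1 / 2)) (-aC * 2) (-(d * q ^ 2) * -2)
      (-5 / 2 - 1) (-1 / 2 - 1) (2 - 1) (-2 - 1) 0 t :=
  deriv_eq_of_eqOn_fourTerm (G_eq_fourTerm q d al) t ht

theorem Guu_eq_fourTerm (q d al t : ℝ) (ht : 0 < t) :
    Guu t q d al = fourTerm (d * q * bC * (-5 / 2) * (-5 / 2 - 1)) (-bC * (-1 / 2) * (-1 / 2 - 1))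
      (-aC * 2 * (2 - 1)) (-(d * q ^ 2) * -2 * (-2 - 1))
      (-5 / 2 - 1 - 1) (-1 / 2 - 1 - 1) (2 - 1 - 1) (-2 - 1 - 1) 0 t :=
  deriv_eq_of_eqOn_fourTerm (Gu_eq_fourTerm q d al) t ht

theorem Guuu_eq_fourTerm (q d al t : ℝ) (ht : 0 < t) :
    Guuu t q d al = fourTerm (d * q * bC * (-5 / 2) * (-5 / 2 - 1) * (-5 / 2 - 1 - 1))
      (-bC * (-1 / 2) * (-1 / 2 - 1) * (-1 / 2 - 1 - 1))
      (-aC * 2 * (2 - 1) * (2 - 1 - 1)) (-(d * q ^ 2) * -2 * (-2 - 1) * (-2 - 1 - 1))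
      (-5 / 2 - 1 - 1 - 1) (-1 / 2 - 1 - 1 - 1) (2 - 1 - 1 - 1) (-2 - 1 - 1 - 1) 0 t :=
  deriv_eq_of_eqOn_fourTerm (Guu_eq_fourTerm q d al) t ht

theorem G_sq (q d al : ℝ) {r : ℝ} (hr : 0 < r) :
    G (r ^ 2) q d al = d * q * bC / r ^ 5 - bC / r - aC * r ^ 4 - d * q ^ 2 / r ^ 4
      + (aC * d * q + q + al) := by
  rw [G_eq_fourTerm _ _ _ _ (by positivity), fourTerm,
    sq_rpow_half_int hr (-5) _ (by norm_num), sq_rpow_half_int hr (-1) _ (by norm_num),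
    sq_rpow_half_int hr 4 _ (by norm_num), sq_rpow_half_int hr (-4) _ (by norm_num)]
  simp only [zpow_neg, zpow_ofNat]
  ring

theorem Gu_sq (q d al : ℝ) {r : ℝ} (hr : 0 < r) :
    Gu (r ^ 2) q d al = -5 / 2 * (d * q * bC) / r ^ 7 + bC / 2 / r ^ 3 - 2 * aC * r ^ 2
      + 2 * d * q ^ 2 / r ^ 6 := by
  rw [Gu_eq_fourTerm _ _ _ _ (by positivity), fourTerm,
    sq_rpow_half_int hr (-7) _ (by norm_num), sq_rpow_half_int hr (-3) _ (by norm_num),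
    sq_rpow_half_int hr 2 _ (by norm_num), sq_rpow_half_int hr (-6) _ (by norm_num)]
  simp only [zpow_neg, zpow_ofNat]
  ring

theorem Guu_sq (q d al : ℝ) {r : ℝ} (hr : 0 < r) :
    Guu (r ^ 2) q d al = 35 / 4 * (d * q * bC) / r ^ 9 - 3 / 4 * bC / r ^ 5 - 2 * aC
      - 6 * d * q ^ 2 / r ^ 8 := by
  rw [Guu_eq_fourTerm _ _ _ _ (by positivity), fourTerm,
    sq_rpow_half_int hr (-9) _ (by norm_num), sq_rpow_half_int hr (-5) _ (by norm_num),
    sq_rpow_half_int hr 0 _ (by norm_num), sq_rpow_half_int hr (-8) _ (by norm_num)]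
  simp only [zpow_neg, zpow_ofNat]
  ring

theorem Guuu_sq (q d al : ℝ) {r : ℝ} (hr : 0 < r) :
    Guuu (r ^ 2) q d al = -315 / 8 * (d * q * bC) / r ^ 11 + 15 / 8 * bC / r ^ 7
      + 24 * d * q ^ 2 / r ^ 10 := by
  rw [Guuu_eq_fourTerm _ _ _ _ (by positivity), fourTerm,
    sq_rpow_half_int hr (-11) _ (by norm_num), sq_rpow_half_int hr (-7) _ (by norm_num),
    sq_rpow_half_int hr (-2) _ (by norm_num), sq_rpow_half_int hr (-10) _ (by norm_num)]
  simp only [zpow_neg, zpow_ofNat]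
  ring

theorem deriv_quadratic (A B C q : ℝ) :
    deriv (fun t : ℝ => A * t ^ 2 + B * t + C) q = 2 * A * q + B := by
  have h := ((((hasDerivAt_id q).pow 2).const_mul A).add ((hasDerivAt_id q).const_mul B)).add_const C
  refine (HasDerivAt.deriv (h.congr_of_eventuallyEq (Filter.Eventually.of_forall
    fun s => ?_))).trans ?_
  · simp
  · simp; ring

theorem Gq_sq (q d al : ℝ) {r : ℝ} (hr : 0 < r) :
    Gq (r ^ 2) q d al = d * bC / r ^ 5 + aC * d + 1 - 2 * d * q / r ^ 4 := by
  have h : (fun t => G (r ^ 2) t d al) = fun t => (-d / r ^ 4) * t ^ 2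
      + (d * bC / r ^ 5 + aC * d + 1) * t + (-bC / r - aC * r ^ 4 + al) := by
    funext t; rw [G_sq _ _ _ hr]; ring
  rw [Gq, h, deriv_quadratic]; ring

theorem Guq_sq (q d al : ℝ) {r : ℝ} (hr : 0 < r) :
    Guq (r ^ 2) q d al = -5 / 2 * d * bC / r ^ 7 + 4 * d * q / r ^ 6 := by
  have h : (fun t => Gu (r ^ 2) t d al) = fun t => (2 * d / r ^ 6) * t ^ 2
      + (-5 / 2 * d * bC / r ^ 7) * t + (bC / 2 / r ^ 3 - 2 * aC * r ^ 2) := by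
    funext t; rw [Gu_sq _ _ _ hr]; ring
  rw [Guq, h, deriv_quadratic]; ring

/-- The third pitchfork `P₃` of the L–H problem, lying in the unphysical region
`q < 0`, `d < 0`. -/
theorem LH_pitchfork_three (u3 q3 d3 al3 : ℝ)
    (hu : u3 = (173 - 70 * Real.sqrt 6) ^ ((1:ℝ)/5) * bC ^ ((2:ℝ)/5) /
      (2 * (2:ℝ) ^ ((2:ℝ)/5) * aC ^ ((2:ℝ)/5)))
    (hq : q3 = -(5*bC*(Real.sqrt 6 - 2)) / (16 * Real.sqrt u3))
    (hd : d3 = -(8 * u3 ^ ((5:ℝ)/2) * (Real.sqrt 6 - 2)) / (5*bC))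
    (hal : al3 = 5*bC*(Real.sqrt 6 - 2) / (2 * Real.sqrt u3)) :
    u3 > 0 ∧ q3 < 0 ∧ d3 < 0 ∧
    G u3 q3 d3 al3 = 0 ∧ Gu u3 q3 d3 al3 = 0 ∧ Gq u3 q3 d3 al3 = 0 ∧
    Guu u3 q3 d3 al3 = 0 ∧ Guq u3 q3 d3 al3 ≠ 0 ∧ Guuu u3 q3 d3 al3 ≠ 0 := by
  set s := Real.sqrt 6 with hs
  have hs2 : s ^ 2 = 6 := Real.sq_sqrt (by norm_num)
  have hs0 : 0 ≤ s := Real.sqrt_nonneg 6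
  have hs1 : 2.449 < s := by nlinarith
  have hs3 : s < 2.4495 := by nlinarith
  have ha : aC = 1 / 20 := rfl
  have hb : bC = 19 / 20 := rfl
  have hc : 0 < 173 - 70 * s := by linarith
  have hu0 : 0 < u3 := by
    rw [hu, ha, hb]; positivity
  have hpow (x y : ℝ) (n : ℕ) (hx : 0 ≤ x) (hy : y * 5 = n) : (x ^ y) ^ 5 = x ^ n := by
    rw [← Real.rpow_natCast, ← Real.rpow_mul hx, ← Real.rpow_natCast, ← hy]; norm_num
  have hu5 : u3 ^ 5 = (19 / 16 * (14 - 5 * s)) ^ 2 := by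
    rw [hu, div_pow, mul_pow, mul_pow, mul_pow, hpow _ _ 1 hc.le (by norm_num),
      hpow _ _ 2 (by rw [hb]; norm_num) (by norm_num), hpow _ _ 2 (by norm_num) (by norm_num),
      hpow _ _ 2 (by rw [ha]; norm_num) (by norm_num), ha, hb]
    linear_combination (-9025 / 256) * hs2
  obtain ⟨r, hr, rfl⟩ : ∃ r : ℝ, 0 < r ∧ u3 = r ^ 2 :=
    ⟨√u3, Real.sqrt_pos.2 hu0, (Real.sq_sqrt hu0.le).symm⟩
  have hr5 : r ^ 5 = 19 / 16 * (14 - 5 * s) :=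
    (pow_left_inj₀ (by positivity) (by linarith) two_ne_zero).1 (by rw [← hu5]; ring)
  rw [Real.sqrt_sq hr.le, hb] at hq hal
  have hd' : d3 = 116 - 48 * s := by
    rw [hd, sq_rpow_half_int hr 5 _ (by norm_num), zpow_ofNat, hr5, hb]
    linear_combination 10 * hs2
  have hd0 : d3 < 0 := by linarith
  have hq' : q3 = -(19 / 64 * (s - 2)) / r := by rw [hq]; ring
  have hal' : al3 = 19 / 8 * (s - 2) / r := by rw [hal]; ring
  have hq0 : q3 < 0 := by
    rw [hq']; exact div_neg_of_neg_of_pos (by linarith) hr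
  obtain ⟨v, hv⟩ : ∃ v, v = r⁻¹ := ⟨_, rfl⟩
  have hv0 : 0 < v := hv ▸ inv_pos.2 hr
  have hrv : r * v = 1 := hv ▸ mul_inv_cancel₀ hr.ne'
  have hv5 : v ^ 5 = 8 / 437 * (14 + 5 * s) := by
    have h1 : r ^ 5 * v ^ 5 = 1 := by rw [← mul_pow, hrv, one_pow]
    rw [hr5] at h1
    linear_combination 8 / 437 * (14 + 5 * s) * h1 + 25 / 46 * v ^ 5 * hs2
  have hr4 : r ^ 4 = 19 / 16 * (14 - 5 * s) * v := by
    linear_combination v * hr5 - r ^ 4 * hrv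
  have hr2 : r ^ 2 = 19 / 16 * (14 - 5 * s) * v ^ 3 := by
    linear_combination v ^ 2 * hr4 - r ^ 2 * (r * v + 1) * hrv
  refine ⟨hu0, hq0, hd0, ?_, ?_, ?_, ?_, ?_, ?_⟩
  · rw [G_sq _ _ _ hr, hq', hal', hd', ha, hb]
    simp only [div_eq_mul_inv, ← inv_pow, ← hv]
    grind
  · rw [Gu_sq _ _ _ hr, hq', hd', ha, hb]
    simp only [div_eq_mul_inv, ← inv_pow, ← hv]
    grind
  · rw [Gq_sq _ _ _ hr, hq', hd', ha, hb]
    simp only [div_eq_mul_inv, ← inv_pow, ← hv]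
    grind
  · rw [Guu_sq _ _ _ hr, hq', hd', ha, hb]
    simp only [div_eq_mul_inv, ← inv_pow, ← hv]
    grind
  · rw [Guq_sq _ _ _ hr]
    have h1 : 0 < d3 * q3 := mul_pos_of_neg_of_neg hd0 hq0
    have h2 : 0 < -5 / 2 * d3 * bC := by rw [hb]; linarith
    have h3 : 0 < 4 * d3 * q3 := by linarith
    positivity
  · have h : Guuu (r ^ 2) q3 d3 al3 = v ^ 7 * (-57/2 + 171/16 * s) := by
      rw [Guuu_sq _ _ _ hr, hq', hd', hb]
      simp only [div_eq_mul_inv, ← inv_pow, ← hv]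
      grind
    rw [h]
    exact mul_ne_zero (by positivity) (by linarith)
end
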